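/- arXiv:2503.22258 — 3 statements merged into one kernel-verified Lean document; each statement's English description precedes it below -/
import Mathlib

section
/- Let G : ℝ^d → [0,∞) be locally bounded, convex outside a ball B_M(0), differentiable with globally Lipschitz gradient, and such that ∫ exp(−G(x)) dx < ∞ and ∫ exp(−M_G^t(x)) dx < ∞ for the fixed t > 0. Define G^t_T(x) = −T log( (2πTt)^{−d/2} ∫ exp( −G(y)/T − ‖x−y‖²/(2Tt) ) dy ), and let π^t_T(x) = exp(−G^t_T(x))/Z(T) with Z(T) = ∫ exp(−G^t_T(x)) dx, and π^t(x) = exp(−M_G^t(x))/Z with Z = ∫ exp(−M_G^t(x)) dx. Then the distribution of annealed Langevin sampling converges to that of DAZ in total variation: ∫ |π^t_T(x) − π^t(x)| dx → 0 as T → 0⁺. -/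
noncomputable section

open MeasureTheory Filter Topology

variable {d : ℕ}

/-- Moreau envelope `M_G^t(x) = inf_y G(y) + ‖x-y‖²/(2t)` (with `M_G^0 := G`). -/
noncomputable def moreau (G : EuclideanSpace ℝ (Fin d) → ℝ) (t : ℝ)
    (x : EuclideanSpace ℝ (Fin d)) : ℝ :=
  if t = 0 then G x else ⨅ y : EuclideanSpace ℝ (Fin d), (G y + ‖x - y‖ ^ 2 / (2 * t))

/-- `G` is locally bounded: bounded above on a neighborhood of every point. -/
def LocBdd (G : EuclideanSpace ℝ (Fin d) → ℝ) : Prop :=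
  ∀ x : EuclideanSpace ℝ (Fin d), ∃ U ∈ nhds x, BddAbove (G '' U)

/-- `G` is convex outside the ball `B_M(0)`. -/
def ConvexOutside (G : EuclideanSpace ℝ (Fin d) → ℝ) (M : ℝ) : Prop :=
  ∀ x y : EuclideanSpace ℝ (Fin d), M ≤ ‖x‖ → M ≤ ‖y‖ →
    ∀ lam ∈ Set.Icc (0 : ℝ) 1,
      G (lam • x + (1 - lam) • y) ≤ lam * G x + (1 - lam) * G y

/-- The diffusion-based potential with temperature `T`. -/
noncomputable def diffPot (G : EuclideanSpace ℝ (Fin d) → ℝ) (t T : ℝ)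
    (x : EuclideanSpace ℝ (Fin d)) : ℝ :=
  -T * Real.log ((2 * Real.pi * T * t) ^ (-(d : ℝ) / 2) *
    ∫ y : EuclideanSpace ℝ (Fin d), Real.exp (-G y / T - ‖x - y‖ ^ 2 / (2 * T * t)))

/-- The function inside the Moreau envelope. -/
def phiAux (G : EuclideanSpace ℝ (Fin d) → ℝ) (t : ℝ) (x y : EuclideanSpace ℝ (Fin d)) : ℝ :=
  G y + ‖x - y‖ ^ 2 / (2 * t)

lemma moreau_eq (G : EuclideanSpace ℝ (Fin d) → ℝ) {t : ℝ} (ht : 0 < t)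
    (x : EuclideanSpace ℝ (Fin d)) : moreau G t x = ⨅ y, phiAux G t x y := by
  simp [moreau, ht.ne', phiAux]

lemma phiAux_nonneg (G : EuclideanSpace ℝ (Fin d) → ℝ) (hG0 : ∀ x, 0 ≤ G x) {t : ℝ} (ht : 0 < t)
    (x y : EuclideanSpace ℝ (Fin d)) : 0 ≤ phiAux G t x y := by
  have := hG0 y
  unfold phiAux
  positivity

lemma moreau_le (G : EuclideanSpace ℝ (Fin d) → ℝ) (hG0 : ∀ x, 0 ≤ G x) {t : ℝ} (ht : 0 < t)
    (x y : EuclideanSpace ℝ (Fin d)) : moreau G t x ≤ phiAux G t x y := by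
  rw [moreau_eq G ht]
  exact ciInf_le ⟨0, by rintro _ ⟨y, rfl⟩; exact phiAux_nonneg G hG0 ht x y⟩ y

lemma moreau_nonneg (G : EuclideanSpace ℝ (Fin d) → ℝ) (hG0 : ∀ x, 0 ≤ G x) {t : ℝ} (ht : 0 < t)
    (x : EuclideanSpace ℝ (Fin d)) : 0 ≤ moreau G t x := by
  rw [moreau_eq G ht]
  exact le_ciInf (phiAux_nonneg G hG0 ht x)

/-- Contraction towards a fixed point at least halves `G`, up to a constant. -/
lemma exists_half (G : EuclideanSpace ℝ (Fin d) → ℝ) (hG0 : ∀ x, 0 ≤ G x) (hGc : Continuous G)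
    (M : ℝ) (hconv : ConvexOutside G M) :
    ∃ (z : EuclideanSpace ℝ (Fin d)) (C : ℝ), ∀ y,
      G ((1/2 : ℝ) • y + (1 - 1/2 : ℝ) • z) ≤ (1/2) * G y + C := by
  have key : ∀ z : EuclideanSpace ℝ (Fin d), ∃ C : ℝ, ∀ y, ‖y‖ ≤ M →
      G ((1/2 : ℝ) • y + (1 - 1/2 : ℝ) • z) ≤ C := by
    intro z
    have hc : ContinuousOn (fun y => G ((1/2 : ℝ) • y + (1 - 1/2 : ℝ) • z))
        (Metric.closedBall 0 M) := by fun_prop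
    obtain ⟨C, hC⟩ := (isCompact_closedBall (0 : EuclideanSpace ℝ (Fin d)) M).bddAbove_image hc
    refine ⟨C, fun y hy => hC ⟨y, by simpa using hy, rfl⟩⟩
  by_cases h : ∃ z : EuclideanSpace ℝ (Fin d), M ≤ ‖z‖
  · obtain ⟨z, hz⟩ := h
    obtain ⟨C, hC⟩ := key z
    refine ⟨z, max C ((1/2) * G z), fun y => ?_⟩
    rcases le_total ‖y‖ M with hy | hy
    · have := hC y hy
      have := hG0 y
      have := le_max_left C ((1/2) * G z)
      linarith
    · have := hconv y z hy hz (1/2) ⟨by norm_num, by norm_num⟩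
      have := le_max_right C ((1/2) * G z)
      linarith
  · push Not at h
    obtain ⟨C, hC⟩ := key 0
    refine ⟨0, C, fun y => ?_⟩
    have := hC y (h y).le
    have := hG0 y
    linarith

lemma moreau_half (G : EuclideanSpace ℝ (Fin d) → ℝ) (hG0 : ∀ x, 0 ≤ G x) {t : ℝ} (ht : 0 < t)
    (z : EuclideanSpace ℝ (Fin d)) (C : ℝ)
    (h : ∀ y, G ((1/2 : ℝ) • y + (1 - 1/2 : ℝ) • z) ≤ (1/2) * G y + C)
    (x : EuclideanSpace ℝ (Fin d)) :
    moreau G t ((1/2 : ℝ) • x + (1 - 1/2 : ℝ) • z) ≤ (1/2) * moreau G t x + C := by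
  have h1 : 2 * (moreau G t ((1/2 : ℝ) • x + (1 - 1/2 : ℝ) • z) - C) ≤ moreau G t x := by
    rw [moreau_eq G ht x]
    refine le_ciInf fun y => ?_
    have h2 := moreau_le G hG0 ht ((1/2 : ℝ) • x + (1 - 1/2 : ℝ) • z)
      ((1/2 : ℝ) • y + (1 - 1/2 : ℝ) • z)
    unfold phiAux at *
    have h3 : ((1/2 : ℝ) • x + (1 - 1/2 : ℝ) • z) - ((1/2 : ℝ) • y + (1 - 1/2 : ℝ) • z)
      = (1/2 : ℝ) • (x - y) := by module
    rw [h3, norm_smul] at h2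
    have h4 := h y
    have h5 : (‖(1/2 : ℝ)‖ * ‖x - y‖) ^ 2 / (2 * t) = (1/4) * (‖x - y‖ ^ 2 / (2 * t)) := by
      norm_num [mul_pow]; ring
    rw [h5] at h2
    have h6 : 0 ≤ ‖x - y‖ ^ 2 / (2 * t) := by positivity
    linarith
  linarith

lemma integrable_half (G : EuclideanSpace ℝ (Fin d) → ℝ) (hG0 : ∀ x, 0 ≤ G x) {t : ℝ} (ht : 0 < t)
    (hGc : Continuous G) (M : ℝ) (hconv : ConvexOutside G M)
    (hMint : Integrable (fun x : EuclideanSpace ℝ (Fin d) => Real.exp (-moreau G t x))) :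
    Integrable (fun x : EuclideanSpace ℝ (Fin d) => Real.exp (-(moreau G t x / 2))) := by
  obtain ⟨z, C, h⟩ := exists_half G hG0 hGc M hconv
  have h1 : Integrable (fun x : EuclideanSpace ℝ (Fin d) =>
      Real.exp (-moreau G t ((1/2 : ℝ) • x + (1 - 1/2 : ℝ) • z))) := by
    have h2 := hMint.comp_add_right ((1 - 1/2 : ℝ) • z)
    exact h2.comp_smul (R := (1/2 : ℝ)) (by norm_num)
  refine (h1.const_mul (Real.exp C)).mono' ?_ (ae_of_all _ fun x => ?_)
  · have : (fun x : EuclideanSpace ℝ (Fin d) => Real.exp (-(moreau G t x / 2)))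
        = fun x => Real.sqrt (Real.exp (-moreau G t x)) := by
      ext x
      rw [Real.sqrt_eq_rpow, ← Real.exp_mul]
      congr 1; ring
    rw [this]
    exact Real.continuous_sqrt.comp_aestronglyMeasurable hMint.1
  · rw [Real.norm_eq_abs, abs_of_pos (Real.exp_pos _), ← Real.exp_add]
    have := moreau_half G hG0 ht z C h x
    apply Real.exp_le_exp.2
    linarith

lemma integrable_gauss {b : ℝ} (hb : 0 < b) (x : EuclideanSpace ℝ (Fin d)) :
    Integrable (fun y : EuclideanSpace ℝ (Fin d) => Real.exp (-b * ‖x - y‖ ^ 2)) := by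
  have h : Integrable (fun y : EuclideanSpace ℝ (Fin d) => Real.exp (-b * ‖y‖ ^ 2)) := by
    have := (GaussianFourier.integrable_cexp_neg_mul_sq_norm_add (V := EuclideanSpace ℝ (Fin d))
      (b := (b : ℂ)) (by simpa using hb) 0 0).norm
    refine this.congr (ae_of_all _ fun y => ?_)
    simp [Complex.norm_exp, ← Complex.ofReal_pow]
  exact h.comp_sub_left x

lemma integral_gauss {b : ℝ} (hb : 0 < b) (x : EuclideanSpace ℝ (Fin d)) :
    ∫ y : EuclideanSpace ℝ (Fin d), Real.exp (-b * ‖x - y‖ ^ 2)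
      = (Real.pi / b) ^ ((d : ℝ) / 2) := by
  rw [integral_sub_left_eq_self (fun y : EuclideanSpace ℝ (Fin d) => Real.exp (-b * ‖y‖ ^ 2))
    volume x, GaussianFourier.integral_rexp_neg_mul_sq_norm hb]
  simp

/-- The partition integral. -/
def intI (G : EuclideanSpace ℝ (Fin d) → ℝ) (t T : ℝ) (x : EuclideanSpace ℝ (Fin d)) : ℝ :=
  ∫ y : EuclideanSpace ℝ (Fin d), Real.exp (-G y / T - ‖x - y‖ ^ 2 / (2 * T * t))

lemma expo_eq (G : EuclideanSpace ℝ (Fin d) → ℝ) {t T : ℝ} (ht : 0 < t) (hT : 0 < T)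
    (x y : EuclideanSpace ℝ (Fin d)) :
    -G y / T - ‖x - y‖ ^ 2 / (2 * T * t) = -(phiAux G t x y / T) := by
  unfold phiAux; field_simp; ring

lemma expo_le (G : EuclideanSpace ℝ (Fin d) → ℝ) (hG0 : ∀ x, 0 ≤ G x) {t T : ℝ} (ht : 0 < t)
    (hT : 0 < T) (hT1 : T < 1) (x y : EuclideanSpace ℝ (Fin d)) :
    Real.exp (-G y / T - ‖x - y‖ ^ 2 / (2 * T * t)) ≤
      Real.exp (-((1 - T) * moreau G t x / T)) * Real.exp (-(1 / (2 * t)) * ‖x - y‖ ^ 2) := by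
  rw [expo_eq G ht hT, ← Real.exp_add]
  apply Real.exp_le_exp.2
  have h1 := moreau_le G hG0 ht x y
  have h2 : ‖x - y‖ ^ 2 / (2 * t) ≤ phiAux G t x y := by
    have := hG0 y; unfold phiAux; linarith
  have h3 : (1 - T) * moreau G t x + T * (‖x - y‖ ^ 2 / (2 * t)) ≤ phiAux G t x y := by
    nlinarith
  have h4 : ((1 - T) * moreau G t x + T * (‖x - y‖ ^ 2 / (2 * t))) / T ≤ phiAux G t x y / T := by
    gcongr
  have h5 : ((1 - T) * moreau G t x + T * (‖x - y‖ ^ 2 / (2 * t))) / T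
    = (1 - T) * moreau G t x / T + 1 / (2 * t) * ‖x - y‖ ^ 2 := by field_simp
  linarith

lemma integrable_I (G : EuclideanSpace ℝ (Fin d) → ℝ) (hG0 : ∀ x, 0 ≤ G x) (hGc : Continuous G)
    {t T : ℝ} (ht : 0 < t) (hT : 0 < T) (hT1 : T < 1) (x : EuclideanSpace ℝ (Fin d)) :
    Integrable (fun y : EuclideanSpace ℝ (Fin d) =>
      Real.exp (-G y / T - ‖x - y‖ ^ 2 / (2 * T * t))) := by
  refine ((integrable_gauss (b := 1 / (2 * t)) (by positivity) x).const_mul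
    (Real.exp (-((1 - T) * moreau G t x / T)))).mono' ?_ (ae_of_all _ fun y => ?_)
  · exact Continuous.aestronglyMeasurable (by fun_prop)
  · rw [Real.norm_eq_abs, abs_of_pos (Real.exp_pos _)]
    exact expo_le G hG0 ht hT hT1 x y

lemma intI_pos (G : EuclideanSpace ℝ (Fin d) → ℝ) (hG0 : ∀ x, 0 ≤ G x) (hGc : Continuous G)
    {t T : ℝ} (ht : 0 < t) (hT : 0 < T) (hT1 : T < 1) (x : EuclideanSpace ℝ (Fin d)) :
    0 < intI G t T x := integral_exp_pos (integrable_I G hG0 hGc ht hT hT1 x)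

lemma neg_diffPot (G : EuclideanSpace ℝ (Fin d) → ℝ) (hG0 : ∀ x, 0 ≤ G x) (hGc : Continuous G)
    {t T : ℝ} (ht : 0 < t) (hT : 0 < T) (hT1 : T < 1) (x : EuclideanSpace ℝ (Fin d)) :
    -diffPot G t T x = -((d : ℝ) / 2) * (T * Real.log (2 * Real.pi * t * T))
      + T * Real.log (intI G t T x) := by
  have hI := intI_pos G hG0 hGc ht hT hT1 x
  unfold diffPot
  change - (-T * Real.log (_ * intI G t T x)) = _
  have hp : 0 < 2 * Real.pi * T * t := by positivity
  rw [Real.log_mul (Real.rpow_pos_of_pos hp _).ne' hI.ne', Real.log_rpow hp,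
    show 2 * Real.pi * T * t = 2 * Real.pi * t * T by ring]
  ring

lemma neg_diffPot_le (G : EuclideanSpace ℝ (Fin d) → ℝ) (hG0 : ∀ x, 0 ≤ G x) (hGc : Continuous G)
    {t T : ℝ} (ht : 0 < t) (hT : 0 < T) (hT1 : T < 1) (x : EuclideanSpace ℝ (Fin d)) :
    -diffPot G t T x ≤ -((1 - T) * moreau G t x) - ((d : ℝ) / 2) * (T * Real.log T) := by
  have hI := intI_pos G hG0 hGc ht hT hT1 x
  have hb : 0 < 1 / (2 * t) := by positivity
  have h1 : intI G t T x ≤ Real.exp (-((1 - T) * moreau G t x / T)) *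
      (2 * Real.pi * t) ^ ((d : ℝ) / 2) := by
    have h2 := integral_mono (integrable_I G hG0 hGc ht hT hT1 x)
      ((integrable_gauss hb x).const_mul (Real.exp (-((1 - T) * moreau G t x / T))))
      (expo_le G hG0 ht hT hT1 x)
    rw [integral_const_mul, integral_gauss hb,
      show Real.pi / (1 / (2 * t)) = 2 * Real.pi * t by field_simp] at h2
    exact h2
  have hp : 0 < 2 * Real.pi * t := by positivity
  have h3 := Real.log_le_log hI h1
  rw [Real.log_mul (Real.exp_pos _).ne' (Real.rpow_pos_of_pos hp _).ne', Real.log_rpow hp,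
    Real.log_exp] at h3
  rw [neg_diffPot G hG0 hGc ht hT hT1, Real.log_mul hp.ne' hT.ne']
  have h4 := mul_le_mul_of_nonneg_left h3 hT.le
  have h5 : T * (-((1 - T) * moreau G t x / T) + (d : ℝ) / 2 * Real.log (2 * Real.pi * t))
    = -((1 - T) * moreau G t x) + (d : ℝ) / 2 * (T * Real.log (2 * Real.pi * t)) := by
    field_simp
  rw [h5] at h4
  linarith

lemma tendsto_TlogT (k : ℝ) (hk : 0 < k) :
    Tendsto (fun T : ℝ => T * Real.log (k * T)) (𝓝[>] 0) (𝓝 0) := by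
  have h : Continuous (fun T : ℝ => (1 / k) * ((k * T) * Real.log (k * T))) :=
    continuous_const.mul (Real.continuous_mul_log.comp (by fun_prop))
  have h2 := (h.tendsto 0).mono_left (nhdsWithin_le_nhds (s := Set.Ioi 0))
  simp only [mul_zero, zero_mul] at h2
  refine h2.congr fun T => ?_
  field_simp

lemma le_neg_diffPot (G : EuclideanSpace ℝ (Fin d) → ℝ) (hG0 : ∀ x, 0 ≤ G x) (hGc : Continuous G)
    {t : ℝ} (ht : 0 < t) (x : EuclideanSpace ℝ (Fin d)) {δ : ℝ} (hδ : 0 < δ) :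
    ∃ v : ℝ, ∀ T : ℝ, 0 < T → T < 1 →
      -((d : ℝ) / 2) * (T * Real.log (2 * Real.pi * t * T)) + (-(moreau G t x + δ) + T * v)
        ≤ -diffPot G t T x := by
  obtain ⟨y0, hy0⟩ : ∃ y, phiAux G t x y < moreau G t x + δ := by
    apply exists_lt_of_ciInf_lt
    rw [← moreau_eq G ht]; linarith
  have hφ : Continuous (phiAux G t x) := by unfold phiAux; fun_prop
  have hopen : IsOpen {y | phiAux G t x y < moreau G t x + δ} := isOpen_lt hφ continuous_const
  obtain ⟨r, hr, hball⟩ := Metric.isOpen_iff.1 hopen y0 hy0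
  set B := Metric.ball y0 r
  have hv : 0 < volume.real B :=
    ENNReal.toReal_pos (Metric.measure_ball_pos volume y0 hr).ne' measure_ball_lt_top.ne
  refine ⟨Real.log (volume.real B), fun T hT hT1 => ?_⟩
  have hI := integrable_I G hG0 hGc ht hT hT1 x
  have h1 : Real.exp (-((moreau G t x + δ) / T)) * volume.real B ≤ intI G t T x := by
    calc Real.exp (-((moreau G t x + δ) / T)) * volume.real B
        = ∫ y in B, Real.exp (-((moreau G t x + δ) / T)) := by
          rw [setIntegral_const, smul_eq_mul, mul_comm]
      _ ≤ ∫ y in B, Real.exp (-G y / T - ‖x - y‖ ^ 2 / (2 * T * t)) := by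
          refine setIntegral_mono_on (integrableOn_const measure_ball_lt_top.ne) hI.integrableOn
            measurableSet_ball fun y hy => ?_
          rw [expo_eq G ht hT]
          have : phiAux G t x y ≤ moreau G t x + δ := (hball hy).le
          apply Real.exp_le_exp.2
          gcongr
      _ ≤ intI G t T x := setIntegral_le_integral hI (ae_of_all _ fun y => (Real.exp_pos _).le)
  have h3 := Real.log_le_log (by positivity) h1
  rw [Real.log_mul (Real.exp_pos _).ne' hv.ne', Real.log_exp] at h3
  rw [neg_diffPot G hG0 hGc ht hT hT1]
  have h4 := mul_le_mul_of_nonneg_left h3 hT.le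
  have h5 : T * (-((moreau G t x + δ) / T) + Real.log (volume.real B))
    = -(moreau G t x + δ) + T * Real.log (volume.real B) := by field_simp
  linarith

lemma tendsto_neg_diffPot (G : EuclideanSpace ℝ (Fin d) → ℝ) (hG0 : ∀ x, 0 ≤ G x)
    (hGc : Continuous G) {t : ℝ} (ht : 0 < t) (x : EuclideanSpace ℝ (Fin d)) :
    Tendsto (fun T => -diffPot G t T x) (𝓝[>] 0) (𝓝 (-moreau G t x)) := by
  have hev : ∀ᶠ T : ℝ in 𝓝[>] 0, 0 < T ∧ T < 1 := Ioo_mem_nhdsGT one_pos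
  have hid : Tendsto (fun T : ℝ => T) (𝓝[>] 0) (𝓝 0) := nhdsWithin_le_nhds
  rw [tendsto_order]
  constructor
  · intro a ha
    obtain ⟨v, hv⟩ := le_neg_diffPot G hG0 hGc ht x (δ := (-moreau G t x - a) / 2) (by linarith)
    have hlim : Tendsto (fun T : ℝ => -((d : ℝ) / 2) * (T * Real.log (2 * Real.pi * t * T)) +
        (-(moreau G t x + (-moreau G t x - a) / 2) + T * v)) (𝓝[>] 0)
        (𝓝 (-((d : ℝ) / 2) * 0 + (-(moreau G t x + (-moreau G t x - a) / 2) + 0 * v))) :=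
      ((tendsto_TlogT (2 * Real.pi * t) (by positivity)).const_mul _).add
        (tendsto_const_nhds.add (hid.mul_const v))
    filter_upwards [hev, hlim.eventually (lt_mem_nhds (show a < _ by linarith))] with T hT h1
    exact h1.trans_le (hv T hT.1 hT.2)
  · intro a ha
    have hlim : Tendsto (fun T : ℝ => -((1 - T) * moreau G t x) -
        ((d : ℝ) / 2) * (T * Real.log T)) (𝓝[>] 0)
        (𝓝 (-((1 - 0) * moreau G t x) - ((d : ℝ) / 2) * 0)) := by
      have := tendsto_TlogT 1 one_pos
      simp only [one_mul] at this
      exact (((tendsto_const_nhds.sub hid).mul_const _).neg).sub (this.const_mul _)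
    filter_upwards [hev, hlim.eventually (gt_mem_nhds (show _ < a by linarith))] with T hT h1
    exact (neg_diffPot_le G hG0 hGc ht hT.1 hT.2 x).trans_lt h1

lemma measurable_diffPot (G : EuclideanSpace ℝ (Fin d) → ℝ) (hGc : Continuous G) (t T : ℝ) :
    Measurable (diffPot G t T) := by
  have h : StronglyMeasurable (fun x : EuclideanSpace ℝ (Fin d) =>
      ∫ y : EuclideanSpace ℝ (Fin d), Real.exp (-G y / T - ‖x - y‖ ^ 2 / (2 * T * t))) := by
    apply StronglyMeasurable.integral_prod_right
      (f := fun x y => Real.exp (-G y / T - ‖x - y‖ ^ 2 / (2 * T * t)))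
    apply Continuous.stronglyMeasurable
    unfold Function.uncurry
    fun_prop
  unfold diffPot
  exact (Real.measurable_log.comp (h.measurable.const_mul _)).const_mul _

lemma exp_diffPot_bound (G : EuclideanSpace ℝ (Fin d) → ℝ) (hG0 : ∀ x, 0 ≤ G x)
    (hGc : Continuous G) {t T : ℝ} (ht : 0 < t) (hT : 0 < T) (hT1 : T < 1 / 2)
    (x : EuclideanSpace ℝ (Fin d)) :
    Real.exp (-diffPot G t T x) ≤ Real.exp ((d : ℝ) / 2) * Real.exp (-(moreau G t x / 2)) := by
  rw [← Real.exp_add]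
  apply Real.exp_le_exp.2
  have h1 := neg_diffPot_le G hG0 hGc ht hT (by linarith) x
  have h2 := moreau_nonneg G hG0 ht x
  have h3 : -1 ≤ T * Real.log T := by
    have h4 := Real.one_sub_inv_le_log_of_pos hT
    have h5 := mul_le_mul_of_nonneg_left h4 hT.le
    rw [mul_sub, mul_inv_cancel₀ hT.ne'] at h5
    linarith
  have h6 : 0 ≤ (d : ℝ) / 2 := by positivity
  nlinarith

/-- the annealed-Langevin distribution `π^t_T ∝ exp(−G^t_T)` converges to the
DAZ distribution `π^t ∝ exp(−M_G^t)` in total variation (equivalently in `L¹`) as `T → 0⁺`. -/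
theorem annealed_tendsto_daz_TV
    (G : EuclideanSpace ℝ (Fin d) → ℝ) (hG0 : ∀ x, 0 ≤ G x) (hloc : LocBdd G)
    (M : ℝ) (hM : 0 < M) (hconv : ConvexOutside G M)
    (hGdiff : Differentiable ℝ G)
    (hGgradLip : ∃ L : NNReal, LipschitzWith L (fun x => gradient G x))
    (hGint : Integrable (fun x : EuclideanSpace ℝ (Fin d) => Real.exp (-G x)))
    (t : ℝ) (ht : 0 < t)
    (hMint : Integrable (fun x : EuclideanSpace ℝ (Fin d) => Real.exp (-moreau G t x))) :
    Tendsto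
      (fun T => ∫ x : EuclideanSpace ℝ (Fin d),
        |Real.exp (-diffPot G t T x) /
            (∫ z : EuclideanSpace ℝ (Fin d), Real.exp (-diffPot G t T z)) -
          Real.exp (-moreau G t x) /
            (∫ z : EuclideanSpace ℝ (Fin d), Real.exp (-moreau G t z))|)
      (𝓝[>] (0 : ℝ)) (𝓝 0) := by
  have hGc : Continuous G := hGdiff.continuous
  have hhalf := integrable_half G hG0 ht hGc M hconv hMint
  set g : EuclideanSpace ℝ (Fin d) → ℝ :=
    fun x => Real.exp ((d : ℝ) / 2) * Real.exp (-(moreau G t x / 2)) with hg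
  have hgint : Integrable g := hhalf.const_mul _
  have hev : ∀ᶠ T : ℝ in 𝓝[>] 0, 0 < T ∧ T < 1 / 2 := Ioo_mem_nhdsGT (by norm_num)
  have hmeas : ∀ T, AEStronglyMeasurable (fun x => Real.exp (-diffPot G t T x)) volume :=
    fun T => ((measurable_diffPot G hGc t T).neg.exp).aestronglyMeasurable
  have hlim : ∀ x, Tendsto (fun T => Real.exp (-diffPot G t T x)) (𝓝[>] 0)
      (𝓝 (Real.exp (-moreau G t x))) := fun x =>
    (Real.continuous_exp.tendsto _).comp (tendsto_neg_diffPot G hG0 hGc ht x)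
  have hZ : Tendsto (fun T => ∫ z, Real.exp (-diffPot G t T z)) (𝓝[>] 0)
      (𝓝 (∫ z, Real.exp (-moreau G t z))) := by
    refine tendsto_integral_filter_of_dominated_convergence g
      (Eventually.of_forall hmeas) ?_ hgint (ae_of_all _ hlim)
    filter_upwards [hev] with T hT
    refine ae_of_all _ fun x => ?_
    rw [Real.norm_eq_abs, abs_of_pos (Real.exp_pos _)]
    exact exp_diffPot_bound G hG0 hGc ht hT.1 hT.2 x
  have hZpos : 0 < ∫ z, Real.exp (-moreau G t z) := integral_exp_pos hMint
  set Z := ∫ z, Real.exp (-moreau G t z) with hZdef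
  have hmain : Tendsto
      (fun T => ∫ x : EuclideanSpace ℝ (Fin d),
        |Real.exp (-diffPot G t T x) /
            (∫ z : EuclideanSpace ℝ (Fin d), Real.exp (-diffPot G t T z)) -
          Real.exp (-moreau G t x) / Z|)
      (𝓝[>] (0 : ℝ)) (𝓝 (∫ x : EuclideanSpace ℝ (Fin d), (0 : ℝ))) := by
    refine tendsto_integral_filter_of_dominated_convergence
      (fun x => g x / (Z / 2) + Real.exp (-moreau G t x) / Z) ?_ ?_
      ((hgint.div_const _).add (hMint.div_const _)) (ae_of_all _ fun x => ?_)
    · refine Eventually.of_forall fun T => ?_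
      exact ((((hmeas T).aemeasurable.div_const _).sub
        (hMint.1.aemeasurable.div_const _)).aestronglyMeasurable).norm
    · filter_upwards [hev, hZ.eventually (lt_mem_nhds (show Z / 2 < Z by linarith))] with T hT h1
      refine ae_of_all _ fun x => ?_
      have h2 := exp_diffPot_bound G hG0 hGc ht hT.1 hT.2 x
      have h3 : 0 < Real.exp (-diffPot G t T x) := Real.exp_pos _
      have h4 : 0 < Real.exp (-moreau G t x) := Real.exp_pos _
      have h5 : Real.exp (-diffPot G t T x) / (∫ z, Real.exp (-diffPot G t T z))
          ≤ g x / (Z / 2) :=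
        div_le_div₀ (h3.le.trans h2) h2 (by positivity) h1.le
      rw [Real.norm_eq_abs, abs_abs]
      refine (abs_sub _ _).trans ?_
      rw [abs_of_pos (div_pos h4 hZpos), abs_of_pos (div_pos h3 (by linarith))]
      gcongr
    · have h1 := (((hlim x).div hZ hZpos.ne').sub_const (Real.exp (-moreau G t x) / Z)).abs
      rw [sub_self, abs_zero] at h1
      exact h1
  rw [integral_zero] at hmain
  exact hmain
end
end

section
/- Let G : ℝ^d → [0,∞) be locally bounded and weakly convex with modulus ρ_G > 0, and let 0 < t < 1/ρ_G (so that y ↦ G(y) + ‖x−y‖²/(2t) is strongly convex and prox_{tG} is single-valued). For T > 0 define the conditional density ρ_T(y|x) = exp( −(G(y) + ‖x−y‖²/(2t))/T ) / ∫ exp( −(G(z) + ‖x−z‖²/(2t))/T ) dz. Then for every x ∈ ℝ^d, the diffusion score converges to the DAZ score as T → 0⁺: (1/t)(x − ∫ y ρ_T(y|x) dy) → (1/t)(x − prox_{tG}(x)) = ∇M_G^t(x). -/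
noncomputable section

open MeasureTheory Filter Topology

variable {d : ℕ}

/-- Proximal map `prox_{tG}(x)` as the set of minimizers of `y ↦ G(y) + ‖x-y‖²/(2t)`. -/
def proxSet (G : EuclideanSpace ℝ (Fin d) → ℝ) (t : ℝ)
    (x : EuclideanSpace ℝ (Fin d)) : Set (EuclideanSpace ℝ (Fin d)) :=
  {p | ∀ y, G p + ‖x - p‖ ^ 2 / (2 * t) ≤ G y + ‖x - y‖ ^ 2 / (2 * t)}

/-- The conditional density
`ρ_T(y|x) = exp(−(G(y)+‖x−y‖²/(2t))/T) / ∫ exp(−(G(z)+‖x−z‖²/(2t))/T) dz`. -/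
noncomputable def condDen (G : EuclideanSpace ℝ (Fin d) → ℝ) (t T : ℝ)
    (x y : EuclideanSpace ℝ (Fin d)) : ℝ :=
  Real.exp (-(G y + ‖x - y‖ ^ 2 / (2 * t)) / T) /
    ∫ z : EuclideanSpace ℝ (Fin d), Real.exp (-(G z + ‖x - z‖ ^ 2 / (2 * t)) / T)

lemma aux_quad {d : ℕ} (G : EuclideanSpace ℝ (Fin d) → ℝ)
    (ρG : ℝ)
    (hwc : ConvexOn ℝ Set.univ (fun y => G y + ρG / 2 * ‖y‖ ^ 2))
    (t : ℝ) (ht0 : 0 < t) (x p : EuclideanSpace ℝ (Fin d)) (hp : p ∈ proxSet G t x)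
    (y : EuclideanSpace ℝ (Fin d)) :
    (G p + ‖x - p‖ ^ 2 / (2 * t)) + (1 / t - ρG) / 2 * ‖y - p‖ ^ 2
      ≤ G y + ‖x - y‖ ^ 2 / (2 * t) := by
  have key : ∀ s ∈ Set.Ioo (0:ℝ) 1, (1 - s) * ((1 / t - ρG) / 2 * ‖y - p‖ ^ 2)
      ≤ (G y + ‖x - y‖ ^ 2 / (2 * t)) - (G p + ‖x - p‖ ^ 2 / (2 * t)) := by
    intro s hs
    have h1 := hwc.2 (Set.mem_univ p) (Set.mem_univ y) (by linarith [hs.2] : 0 ≤ 1 - s) hs.1.le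
      (by ring)
    have h2 := hp ((1 - s) • p + s • y)
    simp only [smul_eq_mul] at h1
    have e1 : ‖(1 - s) • p + s • y‖ ^ 2
        = (1 - s) * ‖p‖ ^ 2 + s * ‖y‖ ^ 2 - s * (1 - s) * ‖y - p‖ ^ 2 := by
      rw [norm_add_sq_real, norm_sub_sq_real, norm_smul, norm_smul, mul_pow, mul_pow,
        inner_smul_left, inner_smul_right, Real.norm_eq_abs, Real.norm_eq_abs, sq_abs, sq_abs,
        real_inner_comm y p]
      simp
      ring
    have e2 : ‖x - ((1 - s) • p + s • y)‖ ^ 2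
        = (1 - s) * ‖x - p‖ ^ 2 + s * ‖x - y‖ ^ 2 - s * (1 - s) * ‖y - p‖ ^ 2 := by
      have a : x - ((1 - s) • p + s • y) = (1 - s) • (x - p) + s • (x - y) := by module
      have b : y - p = (x - p) - (x - y) := by module
      rw [a, b, norm_add_sq_real, norm_sub_sq_real (x - p), norm_smul, norm_smul, mul_pow, mul_pow,
        inner_smul_left, inner_smul_right, Real.norm_eq_abs, Real.norm_eq_abs, sq_abs, sq_abs]
      simp
      ring
    rw [e1] at h1
    rw [e2] at h2
    have hs0 := hs.1
    refine le_of_mul_le_mul_left ?_ hs0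
    have e3 : ((1 - s) * ‖x - p‖ ^ 2 + s * ‖x - y‖ ^ 2 - s * (1 - s) * ‖y - p‖ ^ 2) / (2 * t)
      = (1 - s) * (‖x - p‖ ^ 2 / (2 * t)) + s * (‖x - y‖ ^ 2 / (2 * t))
        - s * (1 - s) * (1 / t / 2 * ‖y - p‖ ^ 2) := by field_simp
    rw [e3] at h2
    nlinarith
  have hl : Tendsto (fun s : ℝ => (1 - s) * ((1 / t - ρG) / 2 * ‖y - p‖ ^ 2)) (𝓝[>] 0)
      (𝓝 ((1 - 0) * ((1 / t - ρG) / 2 * ‖y - p‖ ^ 2))) := by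
    apply Tendsto.mono_left _ nhdsWithin_le_nhds
    exact Continuous.tendsto (by fun_prop) 0
  have := le_of_tendsto hl (by
    filter_upwards [Ioo_mem_nhdsGT (zero_lt_one (α := ℝ))] with s hs using key s hs)
  linarith

lemma aux_grad {d : ℕ} (G : EuclideanSpace ℝ (Fin d) → ℝ) (m : ℝ) (hm : 0 < m)
    (hG0 : ∀ x, 0 ≤ G x)
    (t : ℝ) (ht0 : 0 < t) (x p : EuclideanSpace ℝ (Fin d))
    (hq : ∀ y, (G p + ‖x - p‖ ^ 2 / (2 * t)) + m / 2 * ‖y - p‖ ^ 2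
      ≤ G y + ‖x - y‖ ^ 2 / (2 * t)) :
    HasGradientAt (moreau G t) ((1 / t) • (x - p)) x := by
  have hbdd : ∀ z, BddBelow (Set.range fun y => G y + ‖z - y‖ ^ 2 / (2 * t)) := by
    intro z
    refine ⟨0, ?_⟩
    rintro _ ⟨y, rfl⟩
    have := hG0 y
    positivity
  have hM : ∀ z, moreau G t z = ⨅ y, (G y + ‖z - y‖ ^ 2 / (2 * t)) := fun z => by
    simp [moreau, ht0.ne']
  have hexp : ∀ z y, ‖z - y‖ ^ 2 / (2 * t) = ‖x - y‖ ^ 2 / (2 * t)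
      + 1 / t * inner ℝ (x - p) (z - x) + 1 / t * inner ℝ (p - y) (z - x)
      + ‖z - x‖ ^ 2 / (2 * t) := by
    intro z y
    have a : z - y = (x - y) + (z - x) := by abel
    have b : x - y = (x - p) + (p - y) := by abel
    rw [a, norm_add_sq_real]
    nth_rewrite 2 [b]
    rw [inner_add_left]
    field_simp
    ring
  have hMx : moreau G t x = G p + ‖x - p‖ ^ 2 / (2 * t) := by
    rw [hM]
    apply le_antisymm
    · exact ciInf_le (hbdd x) p
    · apply le_ciInf
      intro y
      have := hq y
      have : 0 ≤ m / 2 * ‖y - p‖ ^ 2 := by positivity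
      linarith
  have hup : ∀ z, moreau G t z - moreau G t x - 1 / t * inner ℝ (x - p) (z - x)
      ≤ 1 / (2 * t) * ‖z - x‖ ^ 2 := by
    intro z
    have h := ciInf_le (hbdd z) p
    rw [← hM] at h
    have e := hexp z p
    simp only [sub_self, inner_zero_left, mul_zero] at e
    rw [hMx]
    have : ‖z - x‖ ^ 2 / (2 * t) = 1 / (2 * t) * ‖z - x‖ ^ 2 := by ring
    linarith
  have hlo : ∀ z, -(1 / (2 * m * t ^ 2) * ‖z - x‖ ^ 2) ≤
      moreau G t z - moreau G t x - 1 / t * inner ℝ (x - p) (z - x) := by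
    intro z
    suffices h : moreau G t x + 1 / t * inner ℝ (x - p) (z - x)
        - (1 / (2 * m * t ^ 2) * ‖z - x‖ ^ 2) ≤ moreau G t z by linarith
    rw [hM z]
    apply le_ciInf
    intro y
    rw [hexp z y, hMx]
    have h1 := hq y
    have h2 : 0 ≤ ‖z - x‖ ^ 2 / (2 * t) := by positivity
    have h3 : 0 ≤ m / 2 * ‖(y - p) - (1 / (m * t)) • (z - x)‖ ^ 2 := by positivity
    have h4 : m / 2 * ‖(y - p) - (1 / (m * t)) • (z - x)‖ ^ 2
       = m / 2 * ‖y - p‖ ^ 2 - 1 / t * inner ℝ (y - p) (z - x)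
         + 1 / (2 * m * t ^ 2) * ‖z - x‖ ^ 2 := by
      rw [norm_sub_sq_real, norm_smul, inner_smul_right, mul_pow, Real.norm_eq_abs, sq_abs]
      field_simp
    have h5 : inner ℝ (p - y) (z - x) = - inner ℝ (y - p) (z - x) := by
      rw [← inner_neg_left, neg_sub]
    rw [h5]
    linarith
  rw [hasGradientAt_iff_isLittleO]
  have hO : (fun z => moreau G t z - moreau G t x - inner ℝ ((1 / t) • (x - p)) (z - x))
      =O[𝓝 x] fun z => ‖z - x‖ ^ 2 := by
    apply Asymptotics.IsBigO.of_bound (1 / (2 * t) + 1 / (2 * m * t ^ 2))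
    filter_upwards with z
    have := hup z
    have := hlo z
    have e : inner ℝ ((1 / t) • (x - p)) (z - x) = 1 / t * inner ℝ (x - p) (z - x) := by
      rw [inner_smul_left]; simp
    have p1 : 0 ≤ 1 / (2 * t) * ‖z - x‖ ^ 2 := by positivity
    have p2 : 0 ≤ 1 / (2 * m * t ^ 2) * ‖z - x‖ ^ 2 := by positivity
    rw [e, Real.norm_eq_abs, Real.norm_eq_abs, abs_of_nonneg (sq_nonneg ‖z - x‖), abs_le]
    constructor <;> linarith
  refine hO.trans_isLittleO ?_
  exact Asymptotics.isLittleO_pow_sub_sub x one_lt_two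

lemma aux_int {d : ℕ} (b : ℝ) (hb : 0 < b) (p : EuclideanSpace ℝ (Fin d)) :
    Integrable (fun y : EuclideanSpace ℝ (Fin d) => Real.exp (-(b * ‖y - p‖ ^ 2))) := by
  have h := GaussianFourier.integrable_cexp_neg_mul_sq_norm_add (V := EuclideanSpace ℝ (Fin d))
    (b := (b : ℂ)) (by simpa using hb) 0 0
  have h2 : Integrable (fun y : EuclideanSpace ℝ (Fin d) => Real.exp (-(b * ‖y‖ ^ 2))) := by
    refine h.norm.congr ?_
    filter_upwards with y
    rw [Complex.norm_exp]
    congr 1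
    simp [← Complex.ofReal_pow]
  exact h2.comp_sub_right p

lemma aux_int2 {d : ℕ} (b : ℝ) (hb : 0 < b) (p : EuclideanSpace ℝ (Fin d)) :
    Integrable (fun y : EuclideanSpace ℝ (Fin d) => ‖y - p‖ * Real.exp (-(b * ‖y - p‖ ^ 2))) := by
  refine ((aux_int (b / 2) (by positivity) p).const_mul (1 + 1 / (2 * b))).mono'
    (by fun_prop) ?_
  filter_upwards with y
  rw [Real.norm_of_nonneg (by positivity)]
  set r := ‖y - p‖
  have e : Real.exp (-(b / 2 * r ^ 2)) = Real.exp (b / 2 * r ^ 2) * Real.exp (-(b * r ^ 2)) := by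
    rw [← Real.exp_add]; congr 1; ring
  rw [e, ← mul_assoc]
  gcongr
  have h1 := Real.add_one_le_exp (b / 2 * r ^ 2)
  have h2 : 0 ≤ 1 / (2 * b) := by positivity
  have h3 : r ≤ b / 2 * r ^ 2 + 1 / (2 * b) := by
    have : b / 2 * r ^ 2 + 1 / (2 * b) - r = b / 2 * (r - 1 / b) ^ 2 := by field_simp; ring
    have : 0 ≤ b / 2 * (r - 1 / b) ^ 2 := by positivity
    linarith
  have h4 : 0 ≤ b / 2 * r ^ 2 := by positivity
  nlinarith

lemma aux_laplace {d : ℕ} (f : EuclideanSpace ℝ (Fin d) → ℝ) (hf : Continuous f)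
    (a : ℝ) (ha : 0 < a) (p : EuclideanSpace ℝ (Fin d)) (hfp : f p = 0)
    (hq : ∀ y, a * ‖y - p‖ ^ 2 ≤ f y) :
    (∀ T > 0, Integrable (fun y => Real.exp (-f y / T))) ∧
    (∀ T > 0, Integrable (fun y => ‖y - p‖ * Real.exp (-f y / T))) ∧
    (∀ T > 0, 0 < ∫ y, Real.exp (-f y / T)) ∧
    Tendsto (fun T => (∫ y, ‖y - p‖ * Real.exp (-f y / T)) / ∫ y, Real.exp (-f y / T))
      (𝓝[>] 0) (𝓝 0) := by
  have hle : ∀ T > 0, ∀ y, Real.exp (-f y / T) ≤ Real.exp (-(a / T * ‖y - p‖ ^ 2)) := by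
    intro T hT y
    apply Real.exp_le_exp.2
    have : -(a / T * ‖y - p‖ ^ 2) = -(a * ‖y - p‖ ^ 2) / T := by ring
    rw [this]
    have := hq y
    gcongr
  have i1 : ∀ T > 0, Integrable (fun y => Real.exp (-f y / T)) := by
    intro T hT
    refine (aux_int (a / T) (by positivity) p).mono'
      (Continuous.aestronglyMeasurable (by fun_prop)) ?_
    filter_upwards with y
    rw [Real.norm_of_nonneg (by positivity)]
    exact hle T hT y
  have i2 : ∀ T > 0, Integrable (fun y => ‖y - p‖ * Real.exp (-f y / T)) := by
    intro T hT
    refine (aux_int2 (a / T) (by positivity) p).mono'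
      (Continuous.aestronglyMeasurable (by fun_prop)) ?_
    filter_upwards with y
    rw [Real.norm_of_nonneg (by positivity)]
    have := hle T hT y
    gcongr
  have i3 : ∀ T > 0, 0 < ∫ y, Real.exp (-f y / T) := fun T hT => integral_exp_pos (i1 T hT)
  refine ⟨i1, i2, i3, ?_⟩
  rw [Metric.tendsto_nhds]
  intro ε hε
  set δ := ε / 2 with hδ
  have hδ0 : 0 < δ := by positivity
  set c := a * δ ^ 2 with hc
  have hc0 : 0 < c := by positivity
  obtain ⟨η, hη, hball⟩ := Metric.continuousAt_iff.1 hf.continuousAt (c / 2) (by positivity)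
  set V := volume.real (Metric.ball p η) with hV
  have hV0 : 0 < V := by
    rw [hV, Measure.real, ENNReal.toReal_pos_iff]
    exact ⟨Metric.measure_ball_pos _ _ hη, measure_ball_lt_top⟩
  have hZ : ∀ T > 0, V * Real.exp (-(c / 2) / T) ≤ ∫ y, Real.exp (-f y / T) := by
    intro T hT
    calc V * Real.exp (-(c / 2) / T)
        = ∫ y in Metric.ball p η, Real.exp (-(c / 2) / T) := by
          rw [setIntegral_const, smul_eq_mul]
      _ ≤ ∫ y in Metric.ball p η, Real.exp (-f y / T) := by
          apply setIntegral_mono_on _ (i1 T hT).integrableOn measurableSet_ball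
          · intro y hy
            have := hball hy
            rw [hfp, Real.dist_eq, sub_zero] at this
            have := (le_abs_self _).trans this.le
            gcongr
          · exact integrableOn_const (by exact measure_ball_lt_top.ne)
      _ ≤ ∫ y, Real.exp (-f y / T) :=
          setIntegral_le_integral (i1 T hT) (by filter_upwards with y; positivity)
  set A := ∫ y, ‖y - p‖ * Real.exp (-f y / 1) with hA
  have hA0 : 0 ≤ A := integral_nonneg fun y => by positivity
  have hN : ∀ T > 0, T < 1 → ∫ y, ‖y - p‖ * Real.exp (-f y / T)
      ≤ δ * (∫ y, Real.exp (-f y / T)) + Real.exp (-(1 / T - 1) * c) * A := by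
    intro T hT hT1
    rw [hA, ← integral_const_mul, ← integral_const_mul, ← integral_add]
    · apply integral_mono (i2 T hT)
      · exact ((i1 T hT).const_mul δ).add ((i2 1 one_pos).const_mul _)
      intro y
      simp only
      rcases le_total ‖y - p‖ δ with h | h
      · have : 0 ≤ Real.exp (-(1 / T - 1) * c) * (‖y - p‖ * Real.exp (-f y / 1)) := by positivity
        have : ‖y - p‖ * Real.exp (-f y / T) ≤ δ * Real.exp (-f y / T) := by gcongr
        linarith
      · have : 0 ≤ δ * Real.exp (-f y / T) := by positivity
        have hcf : c ≤ f y := le_trans (by rw [hc]; gcongr) (hq y)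
        have hT2 : 0 ≤ 1 / T - 1 := by
          rw [sub_nonneg, le_div_iff₀ hT]; linarith
        have h2 : Real.exp (-f y / T) ≤ Real.exp (-(1 / T - 1) * c) * Real.exp (-f y / 1) := by
          rw [← Real.exp_add]
          apply Real.exp_le_exp.2
          have : -f y / T = -(1 / T - 1) * f y + -f y / 1 := by ring
          rw [this]
          nlinarith
        have : ‖y - p‖ * Real.exp (-f y / T)
          ≤ ‖y - p‖ * (Real.exp (-(1 / T - 1) * c) * Real.exp (-f y / 1)) := by gcongr
        linarith
    · exact (i1 T hT).const_mul δ
    · exact (i2 1 one_pos).const_mul _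
  have hlim : Tendsto (fun T : ℝ => A / V * Real.exp c * Real.exp (-(c / 2 * T⁻¹))) (𝓝[>] 0)
      (𝓝 (A / V * Real.exp c * 0)) := by
    apply Tendsto.const_mul
    apply Real.tendsto_exp_neg_atTop_nhds_zero.comp
    exact tendsto_inv_nhdsGT_zero.const_mul_atTop (by positivity)
  rw [mul_zero] at hlim
  filter_upwards [hlim.eventually (gt_mem_nhds hδ0), Ioo_mem_nhdsGT (zero_lt_one (α := ℝ))]
    with T h1 hT
  have hT0 := hT.1
  have hZ0 := i3 T hT0
  rw [Real.dist_eq, sub_zero, abs_of_nonneg (by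
    apply div_nonneg _ hZ0.le
    exact integral_nonneg fun y => by positivity), div_lt_iff₀ hZ0]
  refine (hN T hT0 hT.2).trans_lt ?_
  have h3 := hZ T hT0
  have h4 : Real.exp (-(1 / T - 1) * c) * A
      = (A / V * Real.exp c * Real.exp (-(c / 2 * T⁻¹))) * (V * Real.exp (-(c / 2) / T)) := by
    have : Real.exp (-(1 / T - 1) * c)
        = Real.exp c * Real.exp (-(c / 2 * T⁻¹)) * Real.exp (-(c / 2) / T) := by
      rw [← Real.exp_add, ← Real.exp_add]; congr 1; field_simp; ring
    rw [this]
    field_simp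
  have h5 : Real.exp (-(1 / T - 1) * c) * A < δ * ∫ y, Real.exp (-f y / T) := by
    rw [h4]
    exact (mul_lt_mul_of_pos_right h1 (by positivity)).trans_le (by gcongr)
  have : ε = δ + δ := by rw [hδ]; ring
  rw [this, add_mul]
  linarith

/-- the diffusion score `(1/t)(x − ∫ y ρ_T(y|x) dy)` converges as `T → 0⁺` to
the DAZ score `(1/t)(x − prox_{tG}(x)) = ∇M_G^t(x)`. -/
theorem diffusion_score_tendsto_daz_score
    (G : EuclideanSpace ℝ (Fin d) → ℝ) (hG0 : ∀ x, 0 ≤ G x) (hloc : LocBdd G)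
    (ρG : ℝ) (hρ : 0 < ρG)
    (hwc : ConvexOn ℝ Set.univ (fun y => G y + ρG / 2 * ‖y‖ ^ 2))
    (t : ℝ) (ht : t ∈ Set.Ioo (0 : ℝ) (1 / ρG)) :
    ∀ x : EuclideanSpace ℝ (Fin d), ∀ p ∈ proxSet G t x,
      HasGradientAt (moreau G t) ((1 / t) • (x - p)) x ∧
      Tendsto
        (fun T => (1 / t) • (x - ∫ y : EuclideanSpace ℝ (Fin d), condDen G t T x y • y))
        (𝓝[>] (0 : ℝ)) (𝓝 ((1 / t) • (x - p))) := by
  intro x p hp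
  have ht0 := ht.1
  have hm : 0 < 1 / t - ρG := by
    have := (lt_div_iff₀ hρ).1 ht.2
    rw [sub_pos, lt_div_iff₀ ht0]; linarith
  have hq := aux_quad G ρG hwc t ht0 x p hp
  refine ⟨aux_grad G _ hm hG0 t ht0 x p hq, ?_⟩
  have hGc : Continuous G := by
    have h1 : Continuous (fun y => G y + ρG / 2 * ‖y‖ ^ 2) :=
      continuousOn_univ.1 (hwc.continuousOn isOpen_univ)
    have h2 : G = fun y => (G y + ρG / 2 * ‖y‖ ^ 2) - ρG / 2 * ‖y‖ ^ 2 := by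
      funext y; ring
    rw [h2]
    exact h1.sub (by fun_prop)
  set F : EuclideanSpace ℝ (Fin d) → ℝ := fun y => G y + ‖x - y‖ ^ 2 / (2 * t) with hF
  have hFc : Continuous F := by fun_prop
  obtain ⟨i1, i2, i3, hlim⟩ := aux_laplace (fun y => F y - F p) (by fun_prop)
    ((1 / t - ρG) / 2) (by positivity) p (by simp) (fun y => by have := hq y; simp only [hF]; linarith)
  have hden : ∀ T > 0, ∀ y, condDen G t T x y
      = Real.exp (-(F y - F p) / T) / ∫ z, Real.exp (-(F z - F p) / T) := by
    intro T hT y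
    have e : ∀ z, Real.exp (-(F z - F p) / T) = Real.exp (F p / T) * Real.exp (-F z / T) := by
      intro z; rw [← Real.exp_add]; congr 1; ring
    simp only [e]
    rw [integral_const_mul, mul_div_mul_left _ _ (Real.exp_ne_zero _)]
    rfl
  have hmain : Tendsto (fun T => ∫ y, condDen G t T x y • y) (𝓝[>] (0:ℝ)) (𝓝 p) := by
    rw [tendsto_iff_norm_sub_tendsto_zero]
    refine squeeze_zero' (Eventually.of_forall fun _ => norm_nonneg _) ?_ hlim
    filter_upwards [self_mem_nhdsWithin] with T hT
    have hT0 : 0 < T := hT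
    simp only [hden T hT0]
    set Z := ∫ z, Real.exp (-(F z - F p) / T) with hZ
    have hZ0 : 0 < Z := i3 T hT0
    have j1 : Integrable (fun y => (Real.exp (-(F y - F p) / T) / Z) • p) :=
      ((i1 T hT0).div_const Z).smul_const p
    have j2 : Integrable (fun y => (Real.exp (-(F y - F p) / T) / Z) • (y - p)) := by
      refine ((i2 T hT0).div_const Z).mono' (Continuous.aestronglyMeasurable (by fun_prop)) ?_
      filter_upwards with y
      rw [norm_smul, Real.norm_of_nonneg (by positivity)]
      exact le_of_eq (by ring)
    have e1 : ∫ y, (Real.exp (-(F y - F p) / T) / Z) • p = p := by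
      rw [integral_smul_const, integral_div, ← hZ, div_self hZ0.ne', one_smul]
    have e2 : (∫ y, (Real.exp (-(F y - F p) / T) / Z) • y) - p
        = ∫ y, (Real.exp (-(F y - F p) / T) / Z) • (y - p) := by
      have : ∀ y, (Real.exp (-(F y - F p) / T) / Z) • y
        = (Real.exp (-(F y - F p) / T) / Z) • (y - p) + (Real.exp (-(F y - F p) / T) / Z) • p := by
        intro y; rw [← smul_add, sub_add_cancel]
      simp only [this]
      rw [integral_add j2 j1, e1, add_sub_cancel_right]
    rw [e2]
    refine (norm_integral_le_integral_norm _).trans (le_of_eq ?_)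
    rw [← integral_div]
    congr 1
    funext y
    rw [norm_smul, Real.norm_of_nonneg (by positivity)]
    ring
  exact (tendsto_const_nhds.sub hmain).const_smul _
end
end

section
/- Let G : ℝ^d → [0,∞) be locally bounded, weakly convex with modulus ρ_G > 0, and superexponential with minimizer x*, supex radius M_ρ and supex modulus ρ > 0, and let t > 0. Then there exist c > 0 and R > 0 such that for every x with ‖x‖ ≥ R and every p ∈ prox_{tG}(x) one has ‖p − x*‖ ≤ ‖x − x*‖, and consequently ‖p‖ ≤ ‖x‖ + c. -/
noncomputable section

open scoped RealInnerProductSpace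

variable {d : ℕ}

/-- Regular (Fréchet) subdifferential: `v ∈ ∂G(x)` iff
`liminf_{y→x, y≠x} (G(y) − G(x) − ⟨v, y−x⟩)/‖y−x‖ ≥ 0`. -/
def regSubdiff (G : EuclideanSpace ℝ (Fin d) → ℝ) (x : EuclideanSpace ℝ (Fin d)) :
    Set (EuclideanSpace ℝ (Fin d)) :=
  {v | ∀ ε > 0, ∀ᶠ y in nhdsWithin x {x}ᶜ,
    -(ε * ‖y - x‖) ≤ G y - G x - ⟪v, y - x⟫}

/-- for `G` superexponential there are `c > 0` and `R > 0` such that for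
`‖x‖ ≥ R` every `p ∈ prox_{tG}(x)` satisfies `‖p − x*‖ ≤ ‖x − x*‖`, hence `‖p‖ ≤ ‖x‖ + c`. -/
theorem prox_growth_bound
    (G : EuclideanSpace ℝ (Fin d) → ℝ) (hG0 : ∀ x, 0 ≤ G x) (hloc : LocBdd G)
    (ρG : ℝ) (hρG : 0 < ρG)
    (hwc : ConvexOn ℝ Set.univ (fun y => G y + ρG / 2 * ‖y‖ ^ 2))
    (xstar : EuclideanSpace ℝ (Fin d)) (hmin : ∀ y, G xstar ≤ G y)
    (ρ Mρ : ℝ) (hρ : 0 < ρ) (hMρ : 0 < Mρ)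
    (hsupex : ∀ x : EuclideanSpace ℝ (Fin d), Mρ ≤ ‖x - xstar‖ →
      ∀ v ∈ regSubdiff G x, ρ * ‖x - xstar‖ ^ 2 ≤ ⟪v, x - xstar⟫)
    (t : ℝ) (ht : 0 < t) :
    ∃ c > 0, ∃ R > 0, ∀ x : EuclideanSpace ℝ (Fin d), R ≤ ‖x‖ →
      ∀ p ∈ proxSet G t x, ‖p - xstar‖ ≤ ‖x - xstar‖ ∧ ‖p‖ ≤ ‖x‖ + c := by
  refine ⟨2 * ‖xstar‖ + 1, by positivity, Mρ + ‖xstar‖, by positivity, ?_⟩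
  intro x hx p hp
  have key : ‖p - xstar‖ ≤ ‖x - xstar‖ := by
    have h1 : Mρ ≤ ‖x - xstar‖ := by
      have := norm_sub_norm_le x xstar
      linarith
    rcases le_total ‖p - xstar‖ Mρ with h | h
    · exact h.trans h1
    have hv : (1 / t) • (x - p) ∈ regSubdiff G p := by
      intro ε hε
      have hb : Metric.ball p (2 * t * ε) ∈ nhds p := Metric.ball_mem_nhds p (by positivity)
      filter_upwards [mem_nhdsWithin_of_mem_nhds hb] with y hy
      rw [Metric.mem_ball, dist_eq_norm] at hy
      have h2 := hp y
      have h3 : ‖x - y‖ ^ 2 = ‖x - p‖ ^ 2 - 2 * ⟪x - p, y - p⟫ + ‖y - p‖ ^ 2 := by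
        rw [← norm_sub_sq_real]
        congr 2
        abel
      rw [h3] at h2
      rw [real_inner_smul_left]
      have h4 : ‖y - p‖ ^ 2 / (2 * t) ≤ ε * ‖y - p‖ := by
        rw [div_le_iff₀ (by positivity)]
        nlinarith [norm_nonneg (y - p)]
      have h5 : (‖x - p‖ ^ 2 - 2 * ⟪x - p, y - p⟫ + ‖y - p‖ ^ 2) / (2 * t)
          = ‖x - p‖ ^ 2 / (2 * t) - 1 / t * ⟪x - p, y - p⟫ + ‖y - p‖ ^ 2 / (2 * t) := by
        field_simp
      rw [h5] at h2
      linarith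
    have h6 := hsupex p h _ hv
    rw [real_inner_smul_left] at h6
    have h7 : 0 ≤ ⟪x - p, p - xstar⟫ := by
      have h8 : 0 ≤ 1 / t * ⟪x - p, p - xstar⟫ := le_trans (by positivity) h6
      exact nonneg_of_mul_nonneg_right h8 (by positivity)
    have h9 : ⟪x - p, p - xstar⟫ = ⟪x - xstar, p - xstar⟫ - ‖p - xstar‖ ^ 2 := by
      rw [← real_inner_self_eq_norm_sq, ← inner_sub_left]
      congr 1
      abel
    have h10 := real_inner_le_norm (x - xstar) (p - xstar)
    have h11 : 0 < ‖p - xstar‖ := lt_of_lt_of_le hMρ h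
    nlinarith
  refine ⟨key, ?_⟩
  have h1 := norm_sub_norm_le p xstar
  have h2 := norm_sub_le x xstar
  linarith
end
end
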